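/- As k → (1/√2)⁺, the ratio (1 − φ(k))/√(k − 1/√2) converges to 2·8^{1/4}/K(1/√2), where K(1/√2) = ∫₀¹ dt/√((1−t²)(1−t²/2)). -/

import Mathlib

open Real Filter Set

/-- Complete elliptic integral of the first kind. -/
noncomputable def Kell (k : ℝ) : ℝ :=
  ∫ t in (0:ℝ)..1, 1 / Real.sqrt ((1 - t^2) * (1 - k^2 * t^2))

/-- S(k) = 4√(2k²−1)·K(k). -/
noncomputable def Sfun (k : ℝ) : ℝ := 4 * Real.sqrt (2 * k^2 - 1) * Kell k

/-- H(k), the numerator in the definition of φ. -/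
noncomputable def Hfun (k : ℝ) : ℝ :=
  ∫ t in Real.sqrt ((2 * k^2 - 1) / k^2)..1,
    1 / Real.sqrt ((1 - t^2) * (1 - k^2 * (1 - t^2)))

/-- φ(k) = H(k)/K(k). -/
noncomputable def phiFun (k : ℝ) : ℝ := Hfun k / Kell k

/-- ξ_n = 2|αn − ⌊αn + 1/2⌋|. -/
noncomputable def xiSeq (α : ℝ) (n : ℕ) : ℝ :=
  2 * |α * n - (⌊α * n + 1/2⌋ : ℝ)|

lemma intervalIntegrable_one_div_sqrt_one_sub_sq :
    IntervalIntegrable (fun t : ℝ => 1 / √(1 - t ^ 2)) MeasureTheory.volume 0 1 := by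
  refine intervalIntegral.intervalIntegrable_deriv_of_nonneg (g := arcsin)
    continuous_arcsin.continuousOn (fun x hx => ?_) (fun x _ => by positivity)
  rw [min_eq_left zero_le_one, max_eq_right zero_le_one] at hx
  exact hasDerivAt_arcsin (by linarith [hx.1]) hx.2.ne

lemma norm_one_div_sqrt_mul_le {x y c : ℝ} (hx : 0 ≤ x) (hc : 0 < c) (hy : c ≤ y) :
    ‖1 / √(x * y)‖ ≤ 1 / √c * (1 / √x) := by
  rw [Real.norm_of_nonneg (by positivity), sqrt_mul hx, mul_comm, one_div_mul_one_div]
  rcases (sqrt_nonneg x).eq_or_lt with h | h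
  · simp [← h]
  · have := sqrt_pos.2 hc
    exact one_div_le_one_div_of_le (mul_pos this h)
      (mul_le_mul_of_nonneg_right (sqrt_le_sqrt hy) h.le)

lemma intervalIntegrable_one_div_sqrt_mul {f : ℝ → ℝ} {c : ℝ} (hf : Measurable f) (hc : 0 < c)
    (hcf : ∀ t ∈ Ioc (0 : ℝ) 1, c ≤ f t) :
    IntervalIntegrable (fun t => 1 / √((1 - t ^ 2) * f t)) MeasureTheory.volume 0 1 := by
  refine (intervalIntegrable_one_div_sqrt_one_sub_sq.const_mul (1 / √c)).mono_fun'
    (Measurable.aestronglyMeasurable (by fun_prop)) ?_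
  rw [uIoc_of_le zero_le_one]
  refine (MeasureTheory.ae_restrict_iff' measurableSet_Ioc).2 (.of_forall fun t ht => ?_)
  exact norm_one_div_sqrt_mul_le (by nlinarith [ht.1, ht.2]) hc (hcf t ht)

lemma Kell_pos {k : ℝ} (hk : k ^ 2 < 1) : 0 < Kell k := by
  refine intervalIntegral.intervalIntegral_pos_of_pos_on ?_ (fun t ht => ?_) zero_lt_one
  · refine intervalIntegrable_one_div_sqrt_mul (by fun_prop) (sub_pos.2 hk) fun t ht => ?_
    nlinarith [sq_nonneg k, show t ^ 2 ≤ 1 by nlinarith [ht.1, ht.2]]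
  · have h1 : t ^ 2 < 1 := by nlinarith [ht.1, ht.2]
    have h2 : 0 < 1 - t ^ 2 := by linarith
    have h3 : 0 < 1 - k ^ 2 * t ^ 2 := by nlinarith [sq_nonneg k]
    positivity

/-- The substitution `t = √(1 - u ^ 2)` in the complete elliptic integral. -/
lemma Kell_eq_integral_complementary (k : ℝ) :
    Kell k = ∫ t in (0 : ℝ)..1, 1 / √((1 - t ^ 2) * (1 - k ^ 2 * (1 - t ^ 2))) := by
  have himg : (fun u : ℝ => √(1 - u ^ 2)) '' Ioo 0 1 = Ioo 0 1 := by
    have key : ∀ u ∈ Ioo (0 : ℝ) 1, √(1 - u ^ 2) ∈ Ioo (0 : ℝ) 1 := fun u hu => by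
      refine ⟨sqrt_pos.2 (by nlinarith [hu.1, hu.2]), ?_⟩
      rw [sqrt_lt' one_pos]
      nlinarith [hu.1]
    ext t
    refine ⟨fun ⟨u, hu, h⟩ => h ▸ key u hu, fun ht => ⟨_, key t ht, ?_⟩⟩
    dsimp only
    rw [sq_sqrt (by nlinarith [ht.1, ht.2]), sub_sub_cancel, sqrt_sq ht.1.le]
  have hinj : InjOn (fun u : ℝ => √(1 - u ^ 2)) (Ioo 0 1) := fun u hu v hv h => by
    have := (sqrt_inj (by nlinarith [hu.1, hu.2]) (by nlinarith [hv.1, hv.2])).1 h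
    exact (sq_eq_sq₀ hu.1.le hv.1.le).1 (by linarith)
  have hder : ∀ u ∈ Ioo (0 : ℝ) 1,
      HasDerivWithinAt (fun u : ℝ => √(1 - u ^ 2)) (-u / √(1 - u ^ 2)) (Ioo 0 1) u := by
    intro u hu
    have h1 : 1 - u ^ 2 ≠ 0 := by nlinarith [hu.1, hu.2]
    have h : HasDerivAt (fun u : ℝ => √(1 - u ^ 2)) _ u :=
      ((hasDerivAt_pow 2 u).const_sub 1).sqrt h1
    refine (h.congr_deriv ?_).hasDerivWithinAt
    rw [pow_one, Nat.cast_two, ← mul_neg, mul_div_mul_left _ _ two_ne_zero]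
  have h := MeasureTheory.integral_image_eq_integral_abs_deriv_smul measurableSet_Ioo hder hinj
    (fun t => 1 / √((1 - t ^ 2) * (1 - k ^ 2 * t ^ 2)))
  rw [himg] at h
  rw [Kell, intervalIntegral.integral_of_le zero_le_one,
    intervalIntegral.integral_of_le zero_le_one, MeasureTheory.integral_Ioc_eq_integral_Ioo,
    MeasureTheory.integral_Ioc_eq_integral_Ioo, h]
  refine MeasureTheory.setIntegral_congr_fun measurableSet_Ioo fun u hu => ?_
  have h1 : 0 < 1 - u ^ 2 := by nlinarith [hu.1, hu.2]
  have hu0 := hu.1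
  rw [sq_sqrt h1.le, sub_sub_cancel, sqrt_mul (sq_nonneg u), sqrt_sq hu.1.le, sqrt_mul h1.le,
    abs_div, abs_neg, abs_of_pos hu.1, abs_of_nonneg (sqrt_nonneg _), smul_eq_mul, div_mul_div_comm,
    mul_one, mul_left_comm, div_mul_cancel_left₀ hu0.ne', one_div]

lemma Kell_sub_Hfun {k : ℝ} (hk : k ^ 2 < 1) (hk' : 1 < 2 * k ^ 2) :
    Kell k - Hfun k = ∫ t in (0 : ℝ)..√((2 * k ^ 2 - 1) / k ^ 2),
      1 / √((1 - t ^ 2) * (1 - k ^ 2 * (1 - t ^ 2))) := by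
  have ha : √((2 * k ^ 2 - 1) / k ^ 2) ≤ 1 := by
    rw [sqrt_le_one, div_le_one (by linarith)]
    linarith
  have hint : IntervalIntegrable (fun t => 1 / √((1 - t ^ 2) * (1 - k ^ 2 * (1 - t ^ 2))))
      MeasureTheory.volume 0 1 := by
    refine intervalIntegrable_one_div_sqrt_mul (by fun_prop) (sub_pos.2 hk) fun t ht => ?_
    nlinarith [mul_nonneg (sq_nonneg k) (sq_nonneg t)]
  have hsub : √((2 * k ^ 2 - 1) / k ^ 2) ∈ uIcc (0 : ℝ) 1 := by
    rw [uIcc_of_le zero_le_one]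
    exact ⟨sqrt_nonneg _, ha⟩
  rw [Kell_eq_integral_complementary, Hfun, sub_eq_iff_eq_add,
    intervalIntegral.integral_add_adjacent_intervals]
  · exact hint.mono_set (uIcc_subset_uIcc left_mem_uIcc hsub)
  · exact hint.mono_set (uIcc_subset_uIcc hsub right_mem_uIcc)

lemma Kell_sub_Hfun_mem_Icc {k : ℝ} (hk0 : 0 < k) (hk : k ^ 2 < 1) (hk' : 1 < 2 * k ^ 2) :
    Kell k - Hfun k ∈ Icc (√((2 * k ^ 2 - 1) / k ^ 2) * (1 / k))
      (√((2 * k ^ 2 - 1) / k ^ 2) * (1 / √(1 - k ^ 2))) := by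
  rw [Kell_sub_Hfun hk hk']
  have hsq : k ^ 2 * √((2 * k ^ 2 - 1) / k ^ 2) ^ 2 = 2 * k ^ 2 - 1 := by
    rw [sq_sqrt (div_nonneg (by linarith) (sq_nonneg k))]
    field_simp
  have ha0 := sqrt_nonneg ((2 * k ^ 2 - 1) / k ^ 2)
  set a := √((2 * k ^ 2 - 1) / k ^ 2)
  have ht2 : ∀ t ∈ Icc 0 a, k ^ 2 * t ^ 2 ≤ 2 * k ^ 2 - 1 := fun t ht => by
    rw [← hsq]
    have := ht.1
    have := ht.2
    gcongr
  have hlow : ∀ t ∈ Icc 0 a, 1 - k ^ 2 ≤ (1 - t ^ 2) * (1 - k ^ 2 * (1 - t ^ 2)) := fun t ht => by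
    nlinarith [mul_nonneg (sq_nonneg t) (sub_nonneg.2 (ht2 t ht))]
  have hup : ∀ t ∈ Icc 0 a, (1 - t ^ 2) * (1 - k ^ 2 * (1 - t ^ 2)) ≤ k ^ 2 := fun t ht => by
    nlinarith [ht2 t ht, sq_nonneg t, mul_nonneg (sq_nonneg k) (sq_nonneg t),
      mul_nonneg (sq_nonneg t) (mul_nonneg (sq_nonneg k) (sq_nonneg t)),
      mul_nonneg (sq_nonneg t) (sub_pos.2 hk).le]
  have hk1 : 0 < 1 - k ^ 2 := sub_pos.2 hk
  have hint : IntervalIntegrable (fun t => 1 / √((1 - t ^ 2) * (1 - k ^ 2 * (1 - t ^ 2))))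
      MeasureTheory.volume 0 a := by
    refine ContinuousOn.intervalIntegrable ?_
    rw [uIcc_of_le ha0]
    exact continuousOn_const.div (by fun_prop) fun t ht =>
      (sqrt_pos.2 (hk1.trans_le (hlow t ht))).ne'
  constructor
  · have h := intervalIntegral.integral_mono_on ha0
      (intervalIntegrable_const (c := 1 / k)) hint fun t ht =>
        one_div_le_one_div_of_le (sqrt_pos.2 (hk1.trans_le (hlow t ht)))
          (sqrt_le_iff.2 ⟨hk0.le, hup t ht⟩)
    simpa using h
  · have h := intervalIntegral.integral_mono_on ha0 hint
      (intervalIntegrable_const (c := 1 / √(1 - k ^ 2))) fun t ht =>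
        one_div_le_one_div_of_le (sqrt_pos.2 hk1) (sqrt_le_sqrt (hlow t ht))
    simpa using h

lemma continuousAt_Kell {k₀ : ℝ} (hk₀ : k₀ ^ 2 < 1) : ContinuousAt Kell k₀ := by
  obtain ⟨m, hm, hm1⟩ := exists_between hk₀
  have hev : ∀ᶠ k in nhds k₀, k ^ 2 < m :=
    (continuous_pow 2).continuousAt.eventually (gt_mem_nhds hm)
  refine intervalIntegral.tendsto_integral_filter_of_dominated_convergence
    (fun t => 1 / √(1 - m) * (1 / √(1 - t ^ 2)))
    (.of_forall fun k => Measurable.aestronglyMeasurable (by fun_prop)) ?_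
    (intervalIntegrable_one_div_sqrt_one_sub_sq.const_mul _) ?_
  · filter_upwards [hev] with k hk
    refine .of_forall fun t ht => ?_
    rw [uIoc_of_le zero_le_one] at ht
    have ht1 : t ^ 2 ≤ 1 := by nlinarith [ht.1, ht.2]
    exact norm_one_div_sqrt_mul_le (sub_nonneg.2 ht1) (sub_pos.2 hm1)
      (by nlinarith [sq_nonneg k])
  · filter_upwards [MeasureTheory.compl_mem_ae_iff.2
      (MeasureTheory.measure_singleton (μ := MeasureTheory.volume) (1 : ℝ))] with t ht1 ht
    rw [uIoc_of_le zero_le_one] at ht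
    have ht1 : t < 1 := lt_of_le_of_ne ht.2 ht1
    have h2 : t ^ 2 < 1 := by nlinarith [ht.1]
    have h3 : 0 < (1 - t ^ 2) * (1 - k₀ ^ 2 * t ^ 2) :=
      mul_pos (by linarith) (by nlinarith [sq_nonneg k₀])
    have hc : ContinuousAt (fun k : ℝ => 1 / √((1 - t ^ 2) * (1 - k ^ 2 * t ^ 2))) k₀ :=
      continuousAt_const.div (by fun_prop) (sqrt_pos.2 h3).ne'
    exact hc.tendsto

lemma sqrt_two_mul_sq_sub_one_div_sqrt {k : ℝ} (hk : 1 / √2 < k) :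
    √((2 * k ^ 2 - 1) / k ^ 2) / √(k - 1 / √2) = √(2 * (k + 1 / √2) / k ^ 2) := by
  have h : 0 < k - 1 / √2 := sub_pos.2 hk
  have hp : (1 / √2) ^ 2 = 1 / 2 := by rw [div_pow, sq_sqrt zero_le_two, one_pow]
  rw [← sqrt_div' _ h.le, div_right_comm,
    show 2 * k ^ 2 - 1 = 2 * (k + 1 / √2) * (k - 1 / √2) by linear_combination 2 * hp,
    mul_div_cancel_right₀ _ h.ne']

lemma sqrt_mul_sqrt_two_eq :
    √(2 * (1 / √2 + 1 / √2) / (1 / √2) ^ 2) * √2 = 2 * (8 : ℝ) ^ ((1 : ℝ) / 4) := by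
  have hp : (1 / √2) ^ 2 = 1 / 2 := by rw [div_pow, sq_sqrt zero_le_two, one_pow]
  have h8 : ((8 : ℝ) ^ ((1 : ℝ) / 4)) ^ 4 = 8 := by
    rw [← rpow_natCast, ← rpow_mul (by norm_num)]
    norm_num
  refine (pow_left_inj₀ (by positivity) (by positivity) four_ne_zero).1 ?_
  rw [mul_pow, mul_pow, h8, show (4 : ℕ) = 2 * 2 from rfl, pow_mul, pow_mul √2,
    sq_sqrt (by positivity), sq_sqrt zero_le_two, div_pow, hp, mul_pow, ← two_mul, mul_pow, hp]
  norm_num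

/-- (1 − φ(k))/√(k − 1/√2) → 2·8^{1/4}/K(1/√2) as k → (1/√2)⁺. -/
theorem stmt_12 :
    Filter.Tendsto (fun k => (1 - phiFun k) / Real.sqrt (k - 1 / Real.sqrt 2))
      (nhdsWithin (1 / Real.sqrt 2) (Set.Ioo (1 / Real.sqrt 2) 1))
      (nhds (2 * (8 : ℝ) ^ ((1:ℝ)/4) / Kell (1 / Real.sqrt 2))) := by
  have hp0 : 0 < 1 / √2 := by positivity
  have hp : (1 / √2) ^ 2 = 1 / 2 := by rw [div_pow, sq_sqrt zero_le_two, one_pow]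
  have hp1 : (1 / √2) ^ 2 < 1 := by rw [hp]; norm_num
  have hrat : ContinuousAt (fun k : ℝ => √(2 * (k + 1 / √2) / k ^ 2)) (1 / √2) :=
    (ContinuousAt.div (by fun_prop) (by fun_prop) (by positivity)).sqrt
  have hlow : ContinuousAt (fun k : ℝ => 1 / k) (1 / √2) :=
    continuousAt_const.div continuousAt_id hp0.ne'
  have hup : ContinuousAt (fun k : ℝ => 1 / √(1 - k ^ 2)) (1 / √2) :=
    continuousAt_const.div (by fun_prop) (sqrt_pos.2 (sub_pos.2 hp1)).ne'
  have hup_eq : 1 / √(1 - (1 / √2) ^ 2) = √2 := by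
    rw [hp, show (1 : ℝ) - 1 / 2 = 2⁻¹ by norm_num, sqrt_inv, one_div, inv_inv]
  have hlim_low := (hrat.mul hlow).tendsto.mono_left
    (nhdsWithin_le_nhds (s := Ioo (1 / √2) 1))
  have hlim_up := (hrat.mul hup).tendsto.mono_left
    (nhdsWithin_le_nhds (s := Ioo (1 / √2) 1))
  simp only [Pi.mul_apply] at hlim_low hlim_up
  rw [one_div_one_div, sqrt_mul_sqrt_two_eq] at hlim_low
  rw [hup_eq, sqrt_mul_sqrt_two_eq] at hlim_up
  have hbound : ∀ k ∈ Ioo (1 / √2) 1, (Kell k - Hfun k) / √(k - 1 / √2) ∈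
      Icc (√(2 * (k + 1 / √2) / k ^ 2) * (1 / k))
        (√(2 * (k + 1 / √2) / k ^ 2) * (1 / √(1 - k ^ 2))) := fun k hk => by
    have hk0 : 0 < k := hp0.trans hk.1
    have h := Kell_sub_Hfun_mem_Icc hk0 (by nlinarith [hk.2]) (by nlinarith [hk.1])
    rw [← sqrt_two_mul_sq_sub_one_div_sqrt hk.1, div_mul_eq_mul_div, div_mul_eq_mul_div]
    exact ⟨div_le_div_of_nonneg_right h.1 (sqrt_nonneg _),
      div_le_div_of_nonneg_right h.2 (sqrt_nonneg _)⟩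
  have hnum : Tendsto (fun k => (Kell k - Hfun k) / √(k - 1 / √2))
      (nhdsWithin (1 / √2) (Ioo (1 / √2) 1)) (nhds (2 * (8 : ℝ) ^ ((1 : ℝ) / 4))) :=
    tendsto_of_tendsto_of_tendsto_of_le_of_le' hlim_low hlim_up
      (eventually_nhdsWithin_of_forall fun k hk => (hbound k hk).1)
      (eventually_nhdsWithin_of_forall fun k hk => (hbound k hk).2)
  refine (hnum.div ((continuousAt_Kell hp1).tendsto.mono_left nhdsWithin_le_nhds)
    (Kell_pos hp1).ne').congr' (eventually_nhdsWithin_of_forall fun k hk => ?_)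
  have hK : Kell k ≠ 0 := (Kell_pos (by nlinarith [hk.2, hp0.trans hk.1])).ne'
  simp only [Pi.div_apply]
  rw [phiFun, one_sub_div hK, div_right_comm]
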